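/- arXiv:2401.14224 — 2 statements merged into one kernel-verified Lean document; each statement's English description precedes it below -/
import Mathlib

section
/- Let (X, 𝒜, μ) be a measure space with μ σ-finite, let H : ℝ × X → ℝ be such that for each λ the function x ↦ exp(−H(λ,x)) is μ-integrable with Z(λ) := ∫ exp(−H(λ,x)) dμ(x) > 0, and let ℓ : X → [0,∞) be measurable with Zℓ(λ) := ∫ ℓ(x) exp(−H(λ,x)) dμ(x) finite and strictly positive for each λ. Let Hₚ : ℝ → ℝ be twice differentiable at λ₀. Suppose there is a neighborhood U of λ₀ on which, for μ-almost every x, λ ↦ H(λ,x) is twice differentiable with derivatives ∂λH(λ,x) and ∂²λH(λ,x), and suppose the functions (|∂λH| + |∂λH|² + |∂²λH|) exp(−H) and ℓ·(|∂λH| + |∂λH|² + |∂²λH|) exp(−H) are dominated, uniformly in λ ∈ U, by μ-integrable functions. Define Hd(λ) := −log Zℓ(λ) + log Z(λ) + Hₚ(λ). Then Hd is twice differentiable at λ₀ and Hd''(λ₀) = Var_prior[∂λH(λ₀,·)] − Var_post[∂λH(λ₀,·)] − E_prior[∂²λH(λ₀,·)] + E_post[∂²λH(λ₀,·)] + Hₚ''(λ₀),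 where E_prior and Var_prior denote expectation and variance under the probability measure exp(−H(λ₀,·)) dμ / Z(λ₀), and E_post and Var_post denote expectation and variance under ℓ exp(−H(λ₀,·)) dμ / Zℓ(λ₀). -/
open MeasureTheory Filter Topology

/-- A pointwise almost everywhere derivative of a parametrized family of measurable functions is
measurable. -/
theorem aestronglyMeasurable_of_ae_hasDerivAt {X : Type*} [MeasurableSpace X] {μ : Measure X}
    {F : ℝ → X → ℝ} {F' : X → ℝ} {l : ℝ}
    (hF : ∀ᶠ t in 𝓝 l, AEStronglyMeasurable (F t) μ)
    (hF' : ∀ᵐ x ∂μ, HasDerivAt (fun t => F t x) (F' x) l) :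
    AEStronglyMeasurable F' μ := by
  obtain ⟨u, hu⟩ := Filter.exists_seq_tendsto (𝓝[≠] l)
  obtain ⟨N, hN⟩ := eventually_atTop.1 ((hu.mono_right nhdsWithin_le_nhds).eventually hF)
  refine aestronglyMeasurable_of_tendsto_ae atTop
    (f := fun n x => slope (fun t => F t x) l (u (n + N))) (fun n => ?_) ?_
  · simp only [slope_def_field]
    exact ((hN (n + N) (Nat.le_add_left N n)).sub hF.self_of_nhds).mul_const _
  · filter_upwards [hF'] with x hx
    exact hx.tendsto_slope.comp (hu.comp (tendsto_add_atTop_nat N))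

/-- Differentiation under the integral sign, with measurability of the derivative automatic. -/
theorem integrable_and_hasDerivAt_integral_of_dominated {X : Type*} [MeasurableSpace X]
    {μ : Measure X} {F F' : ℝ → X → ℝ} {g : X → ℝ} {U : Set ℝ} {l : ℝ} (hU : U ∈ 𝓝 l)
    (hF_meas : ∀ᶠ t in 𝓝 l, AEStronglyMeasurable (F t) μ) (hF_int : Integrable (F l) μ)
    (hbound : ∀ᵐ x ∂μ, ∀ t ∈ U, |F' t x| ≤ g x) (hg : Integrable g μ)
    (hderiv : ∀ᵐ x ∂μ, ∀ t ∈ U, HasDerivAt (fun s => F s x) (F' t x) t) :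
    Integrable (F' l) μ ∧ HasDerivAt (fun t => ∫ x, F t x ∂μ) (∫ x, F' l x ∂μ) l :=
  hasDerivAt_integral_of_dominated_loc_of_deriv_le hU hF_meas hF_int
    (aestronglyMeasurable_of_ae_hasDerivAt hF_meas
      (hderiv.mono fun _ hx => hx l (mem_of_mem_nhds hU)))
    hbound hg hderiv

/-- The second derivative of the logarithm of a positive function. -/
theorem hasDerivAt_deriv_log {f f₁ : ℝ → ℝ} {f₂ l : ℝ} (hpos : ∀ t, 0 < f t)
    (hf : ∀ᶠ t in 𝓝 l, HasDerivAt f (f₁ t) t) (hf₁ : HasDerivAt f₁ f₂ l) :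
    HasDerivAt (deriv fun t => Real.log (f t))
      ((1 / f l) * f₂ - ((1 / f l) * f₁ l) ^ 2) l := by
  have heq : (deriv fun t => Real.log (f t)) =ᶠ[𝓝 l] fun t => f₁ t / f t :=
    hf.mono fun t ht => (ht.log (hpos t).ne').deriv
  refine ((hf₁.div hf.self_of_nhds (hpos l).ne').congr_of_eventuallyEq heq).congr_deriv ?_
  have := (hpos l).ne'
  field_simp

/-- The logarithm of a weighted partition function is twice differentiable, and its second
derivative is the variance of the first derivative of the potential minus the mean of the second
one. -/
theorem log_partition_second_derivative {X : Type*} [MeasurableSpace X] {μ : Measure X}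
    {H H' H'' : ℝ → X → ℝ} {w : X → ℝ} (hw : ∀ x, 0 ≤ w x)
    (hint : ∀ l, Integrable (fun x => w x * Real.exp (-H l x)) μ)
    {Z : ℝ → ℝ} (hZ : ∀ l, Z l = ∫ x, w x * Real.exp (-H l x) ∂μ) (hZpos : ∀ l, 0 < Z l)
    {l₀ : ℝ} {U : Set ℝ} (hU : U ∈ 𝓝 l₀)
    (hderiv₁ : ∀ᵐ x ∂μ, ∀ l ∈ U, HasDerivAt (fun t => H t x) (H' l x) l)
    (hderiv₂ : ∀ᵐ x ∂μ, ∀ l ∈ U, HasDerivAt (fun t => H' t x) (H'' l x) l)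
    {g : X → ℝ} (hg : Integrable g μ)
    (hdom : ∀ᵐ x ∂μ, ∀ l ∈ U,
      w x * ((|H' l x| + |H' l x| ^ 2 + |H'' l x|) * Real.exp (-H l x)) ≤ g x) :
    (∀ᶠ l in 𝓝 l₀, DifferentiableAt ℝ (fun t => Real.log (Z t)) l) ∧
    HasDerivAt (deriv fun t => Real.log (Z t))
      ((1 / Z l₀) * (∫ x, w x * (H' l₀ x ^ 2 * Real.exp (-H l₀ x)) ∂μ)
          - ((1 / Z l₀) * ∫ x, w x * (H' l₀ x * Real.exp (-H l₀ x)) ∂μ) ^ 2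
        - (1 / Z l₀) * (∫ x, w x * (H'' l₀ x * Real.exp (-H l₀ x)) ∂μ)) l₀ := by
  obtain rfl : Z = fun l => ∫ x, w x * Real.exp (-H l x) ∂μ := funext hZ
  set K' : ℝ → X → ℝ := fun l x => -(w x * (H' l x * Real.exp (-H l x))) with hK'
  set K'' : ℝ → X → ℝ := fun l x =>
    w x * (H' l x ^ 2 * Real.exp (-H l x)) - w x * (H'' l x * Real.exp (-H l x)) with hK''
  have hK'_deriv : ∀ᵐ x ∂μ, ∀ l ∈ U,
      HasDerivAt (fun t => w x * Real.exp (-H t x)) (K' l x) l := by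
    filter_upwards [hderiv₁] with x hx l hl
    exact ((hx l hl).neg.exp.const_mul (w x)).congr_deriv (by simp only [hK', Pi.neg_apply]; ring)
  have hK''_deriv : ∀ᵐ x ∂μ, ∀ l ∈ U, HasDerivAt (fun t => K' t x) (K'' l x) l := by
    filter_upwards [hderiv₁, hderiv₂] with x hx hx' l hl
    exact (((hx' l hl).mul (hx l hl).neg.exp).const_mul (w x)).neg.congr_deriv
      (by simp only [hK'', Pi.neg_apply]; ring)
  have hK'_bound : ∀ᵐ x ∂μ, ∀ l ∈ U, |K' l x| ≤ g x := by
    filter_upwards [hdom] with x hx l hl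
    refine le_trans ?_ (hx l hl)
    rw [abs_neg, abs_mul, abs_of_nonneg (hw x), abs_mul, abs_of_pos (Real.exp_pos _)]
    gcongr
    · exact hw x
    · linarith [sq_nonneg |H' l x|, abs_nonneg (H'' l x)]
  have hsq_bound : ∀ᵐ x ∂μ, ∀ l ∈ U, |w x * (H' l x ^ 2 * Real.exp (-H l x))| ≤ g x := by
    filter_upwards [hdom] with x hx l hl
    refine le_trans ?_ (hx l hl)
    rw [abs_mul, abs_of_nonneg (hw x), abs_mul, abs_of_pos (Real.exp_pos _), abs_pow]
    gcongr
    · exact hw x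
    · linarith [abs_nonneg (H' l x), abs_nonneg (H'' l x)]
  have hK''_bound : ∀ᵐ x ∂μ, ∀ l ∈ U, |K'' l x| ≤ g x := by
    filter_upwards [hdom] with x hx l hl
    refine le_trans ?_ (hx l hl)
    simp only [hK'']
    rw [← mul_sub, ← sub_mul, abs_mul, abs_of_nonneg (hw x), abs_mul,
      abs_of_pos (Real.exp_pos _)]
    gcongr
    · exact hw x
    · have := abs_sub (H' l x ^ 2) (H'' l x)
      rw [abs_pow] at this
      linarith [abs_nonneg (H' l x)]
  have hfirst : ∀ᶠ l in 𝓝 l₀, Integrable (K' l) μ ∧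
      HasDerivAt (fun t => ∫ x, w x * Real.exp (-H t x) ∂μ) (∫ x, K' l x ∂μ) l :=
    (eventually_mem_nhds_iff.2 hU).mono fun l hl =>
      integrable_and_hasDerivAt_integral_of_dominated hl
        (Eventually.of_forall fun t => (hint t).aestronglyMeasurable) (hint l)
        hK'_bound hg hK'_deriv
  have hK'_int : Integrable (K' l₀) μ := hfirst.self_of_nhds.1
  obtain ⟨hK''_int, hsecond⟩ := integrable_and_hasDerivAt_integral_of_dominated hU
    (hfirst.mono fun t ht => ht.1.aestronglyMeasurable) hK'_int hK''_bound hg hK''_deriv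
  have hsq_int : Integrable (fun x => w x * (H' l₀ x ^ 2 * Real.exp (-H l₀ x))) μ := by
    refine hg.mono' ?_ (hsq_bound.mono fun x hx => hx l₀ (mem_of_mem_nhds hU))
    have heq : (fun x => w x * (H' l₀ x ^ 2 * Real.exp (-H l₀ x))) =
        fun x => K' l₀ x ^ 2 / (w x * Real.exp (-H l₀ x)) := by
      funext x
      rcases eq_or_ne (w x) 0 with h | h
      · simp [h]
      · have := (Real.exp_pos (-H l₀ x)).ne'
        simp only [hK']
        field_simp
    rw [heq]
    exact ((hK'_int.aestronglyMeasurable.aemeasurable.pow_const 2).div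
      (hint l₀).aestronglyMeasurable.aemeasurable).aestronglyMeasurable
  have hsnd_int : Integrable (fun x => w x * (H'' l₀ x * Real.exp (-H l₀ x))) μ :=
    (hsq_int.sub hK''_int).congr (Eventually.of_forall fun x => by simp [hK''])
  refine ⟨hfirst.mono fun l hl => (hl.2.log (hZpos l).ne').differentiableAt, ?_⟩
  refine (hasDerivAt_deriv_log hZpos (hfirst.mono fun l hl => hl.2) hsecond).congr_deriv ?_
  simp only [hK', hK'', integral_neg, integral_sub hsq_int hsnd_int]
  ring

/-- Lemma 3 of the paper, single-parameter case: the parameter posterior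
potential `Hd l = -log (Zℓ l) + log (Z l) + Hp l` is twice differentiable at `l₀` with
second derivative
`Var_prior[H' l₀] - Var_post[H' l₀] - E_prior[H'' l₀] + E_post[H'' l₀] + Hp'' l₀`,
where the prior is `exp (-H l₀ ·) dμ / Z l₀` and the posterior is
`ℓ · exp (-H l₀ ·) dμ / Zℓ l₀`, and variances are `E[(H')²] - (E[H'])²` under the
respective probability measures. -/
theorem stmt_3 {X : Type*} [MeasurableSpace X] (μ : Measure X) [SigmaFinite μ]
    (H H' H'' : ℝ → X → ℝ) (ℓ : X → ℝ) (hℓmeas : Measurable ℓ) (hℓnonneg : ∀ x, 0 ≤ ℓ x)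
    (hint : ∀ l : ℝ, Integrable (fun x => Real.exp (-H l x)) μ)
    (hintℓ : ∀ l : ℝ, Integrable (fun x => ℓ x * Real.exp (-H l x)) μ)
    (Z Zℓ : ℝ → ℝ)
    (hZ : ∀ l, Z l = ∫ x, Real.exp (-H l x) ∂μ)
    (hZℓ : ∀ l, Zℓ l = ∫ x, ℓ x * Real.exp (-H l x) ∂μ)
    (hZpos : ∀ l, 0 < Z l) (hZℓpos : ∀ l, 0 < Zℓ l)
    (Hp : ℝ → ℝ) (l₀ : ℝ) (U : Set ℝ) (hU : U ∈ nhds l₀)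
    (hHp₁ : ∀ l ∈ U, DifferentiableAt ℝ Hp l)
    (Hp'' : ℝ) (hHp₂ : HasDerivAt (deriv Hp) Hp'' l₀)
    (hderiv₁ : ∀ᵐ x ∂μ, ∀ l ∈ U, HasDerivAt (fun t => H t x) (H' l x) l)
    (hderiv₂ : ∀ᵐ x ∂μ, ∀ l ∈ U, HasDerivAt (fun t => H' t x) (H'' l x) l)
    (g₁ g₂ : X → ℝ) (hg₁ : Integrable g₁ μ) (hg₂ : Integrable g₂ μ)
    (hdom₁ : ∀ᵐ x ∂μ, ∀ l ∈ U,
      (|H' l x| + |H' l x| ^ 2 + |H'' l x|) * Real.exp (-H l x) ≤ g₁ x)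
    (hdom₂ : ∀ᵐ x ∂μ, ∀ l ∈ U,
      ℓ x * ((|H' l x| + |H' l x| ^ 2 + |H'' l x|) * Real.exp (-H l x)) ≤ g₂ x) :
    (∀ᶠ l in nhds l₀,
      DifferentiableAt ℝ (fun t => -Real.log (Zℓ t) + Real.log (Z t) + Hp t) l) ∧
    HasDerivAt (deriv (fun t => -Real.log (Zℓ t) + Real.log (Z t) + Hp t))
      ( -- Var_prior[H' l₀]
        ((1 / Z l₀) * (∫ x, H' l₀ x ^ 2 * Real.exp (-H l₀ x) ∂μ)
          - ((1 / Z l₀) * ∫ x, H' l₀ x * Real.exp (-H l₀ x) ∂μ) ^ 2)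
        -- - Var_post[H' l₀]
        - ((1 / Zℓ l₀) * (∫ x, ℓ x * (H' l₀ x ^ 2 * Real.exp (-H l₀ x)) ∂μ)
          - ((1 / Zℓ l₀) * ∫ x, ℓ x * (H' l₀ x * Real.exp (-H l₀ x)) ∂μ) ^ 2)
        -- - E_prior[H'' l₀]
        - (1 / Z l₀) * (∫ x, H'' l₀ x * Real.exp (-H l₀ x) ∂μ)
        -- + E_post[H'' l₀]
        + (1 / Zℓ l₀) * (∫ x, ℓ x * (H'' l₀ x * Real.exp (-H l₀ x)) ∂μ)
        + Hp'') l₀ := by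
  obtain ⟨hdiff, hsecond⟩ := log_partition_second_derivative (w := fun _ => 1)
    (fun _ => zero_le_one) (by simpa using hint) (by simpa using hZ) hZpos hU hderiv₁ hderiv₂ hg₁
    (by simpa using hdom₁)
  obtain ⟨hdiffℓ, hsecondℓ⟩ := log_partition_second_derivative hℓnonneg hintℓ hZℓ hZℓpos hU
    hderiv₁ hderiv₂ hg₂ hdom₂
  simp only [one_mul] at hsecond
  have hdiffp : ∀ᶠ l in 𝓝 l₀, DifferentiableAt ℝ Hp l := mem_of_superset hU hHp₁
  have hderiv : deriv (fun t => -Real.log (Zℓ t) + Real.log (Z t) + Hp t) =ᶠ[𝓝 l₀] fun l =>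
      -deriv (fun t => Real.log (Zℓ t)) l + deriv (fun t => Real.log (Z t)) l + deriv Hp l := by
    filter_upwards [hdiff, hdiffℓ, hdiffp] with l h hℓ hp
    exact ((hℓ.hasDerivAt.neg.add h.hasDerivAt).add hp.hasDerivAt).deriv
  constructor
  · filter_upwards [hdiff, hdiffℓ, hdiffp] with l h hℓ hp
    exact (hℓ.neg.add h).add hp
  · refine (((hsecondℓ.neg.add hsecond).add hHp₂).congr_of_eventuallyEq hderiv).congr_deriv ?_
    ring
end

section
/- Let (X, 𝒜, μ) be a measure space with μ σ-finite, let F : X → ℝ be measurable, and let ℓ : X → [0,∞) be measurable. Assume that for every λ ∈ ℝ the functions exp(−λF), F·exp(−λF), F²·exp(−λF), ℓ·exp(−λF), ℓ·F·exp(−λF), and ℓ·F²·exp(−λF) are μ-integrable, and that Z(λ) := ∫ exp(−λF(x)) dμ(x) > 0 and Zℓ(λ) := ∫ ℓ(x) exp(−λF(x)) dμ(x) > 0 for every λ. Define the parameter posterior potential Hd(λ) := log Z(λ) − log Zℓ(λ). Then Hd is twice differentiable on ℝ with Hd'(λ) = E_post,λ[F] − E_prior,λ[F] and Hd''(λ)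 = Var_prior,λ[F] − Var_post,λ[F], where E_prior,λ and Var_prior,λ denote expectation and variance under exp(−λF) dμ / Z(λ), and E_post,λ and Var_post,λ denote expectation and variance under ℓ exp(−λF) dμ / Zℓ(λ). -/
open MeasureTheory

/-- The prior partition function `Z(λ) = ∫ exp(-λ F x) dμ(x)`. -/
noncomputable def priorZ {X : Type*} [MeasurableSpace X] (μ : Measure X)
    (F : X → ℝ) (l : ℝ) : ℝ :=
  ∫ x, Real.exp (-(l * F x)) ∂μ

/-- The posterior partition function `Zℓ(λ) = ∫ ℓ(x) exp(-λ F x) dμ(x)`. -/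
noncomputable def postZ {X : Type*} [MeasurableSpace X] (μ : Measure X)
    (ℓ F : X → ℝ) (l : ℝ) : ℝ :=
  ∫ x, ℓ x * Real.exp (-(l * F x)) ∂μ

/-- Expectation of `F` under the prior `exp(-λF) dμ / Z(λ)`. -/
noncomputable def priorMean {X : Type*} [MeasurableSpace X] (μ : Measure X)
    (F : X → ℝ) (l : ℝ) : ℝ :=
  (1 / priorZ μ F l) * ∫ x, F x * Real.exp (-(l * F x)) ∂μ

/-- Expectation of `F` under the posterior `ℓ exp(-λF) dμ / Zℓ(λ)`. -/
noncomputable def postMean {X : Type*} [MeasurableSpace X] (μ : Measure X)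
    (ℓ F : X → ℝ) (l : ℝ) : ℝ :=
  (1 / postZ μ ℓ F l) * ∫ x, ℓ x * (F x * Real.exp (-(l * F x))) ∂μ

/-- Variance of `F` under the prior `exp(-λF) dμ / Z(λ)`. -/
noncomputable def priorVar {X : Type*} [MeasurableSpace X] (μ : Measure X)
    (F : X → ℝ) (l : ℝ) : ℝ :=
  (1 / priorZ μ F l) * (∫ x, F x ^ 2 * Real.exp (-(l * F x)) ∂μ) - priorMean μ F l ^ 2

/-- Variance of `F` under the posterior `ℓ exp(-λF) dμ / Zℓ(λ)`. -/
noncomputable def postVar {X : Type*} [MeasurableSpace X] (μ : Measure X)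
    (ℓ F : X → ℝ) (l : ℝ) : ℝ :=
  (1 / postZ μ ℓ F l) * (∫ x, ℓ x * (F x ^ 2 * Real.exp (-(l * F x))) ∂μ)
    - postMean μ ℓ F l ^ 2

/-- Differentiation under the integral sign of an exponential integral with weight `g`. -/
lemma hasDerivAt_integral_mul_exp_neg {X : Type*} [MeasurableSpace X] {μ : Measure X}
    {F g : X → ℝ} (h0 : ∀ l : ℝ, Integrable (fun x => g x * Real.exp (-(l * F x))) μ)
    (h1 : ∀ l : ℝ, Integrable (fun x => g x * (F x * Real.exp (-(l * F x)))) μ) (l : ℝ) :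
    HasDerivAt (fun t => ∫ x, g x * Real.exp (-(t * F x)) ∂μ)
      (-∫ x, g x * (F x * Real.exp (-(l * F x))) ∂μ) l := by
  rw [← integral_neg]
  refine (hasDerivAt_integral_of_dominated_loc_of_deriv_le
    (F' := fun t x => -(g x * (F x * Real.exp (-(t * F x)))))
    (bound := fun x => ‖g x * (F x * Real.exp (-((l - 1) * F x)))‖ +
      ‖g x * (F x * Real.exp (-((l + 1) * F x)))‖)
    (Metric.ball_mem_nhds l one_pos) (.of_forall fun t => (h0 t).aestronglyMeasurable) (h0 l)
    (h1 l).neg.aestronglyMeasurable (.of_forall fun x t ht => ?_)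
    ((h1 (l - 1)).norm.add (h1 (l + 1)).norm) (.of_forall fun x t _ => ?_)).2
  · rw [Metric.mem_ball, Real.dist_eq, abs_lt] at ht
    have hexp : Real.exp (-(t * F x)) ≤
        Real.exp (-((l - 1) * F x)) + Real.exp (-((l + 1) * F x)) := by
      rcases le_total 0 (F x) with hF | hF
      · have : Real.exp (-(t * F x)) ≤ Real.exp (-((l - 1) * F x)) :=
          Real.exp_le_exp.2 (by nlinarith)
        linarith [Real.exp_pos (-((l + 1) * F x))]
      · have : Real.exp (-(t * F x)) ≤ Real.exp (-((l + 1) * F x)) :=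
          Real.exp_le_exp.2 (by nlinarith)
        linarith [Real.exp_pos (-((l - 1) * F x))]
    simp only [norm_neg, norm_mul, Real.norm_eq_abs, Real.abs_exp]
    rw [← mul_add, ← mul_add]
    gcongr
  · have h : HasDerivAt (fun t => -(t * F x)) (-(1 * F x)) t :=
      ((hasDerivAt_id' t).mul_const (F x)).neg
    exact (h.exp.const_mul (g x)).congr_deriv (by ring)

lemma hasDerivAt_log_postZ {X : Type*} [MeasurableSpace X] {μ : Measure X} {w F : X → ℝ}
    (h0 : ∀ l : ℝ, Integrable (fun x => w x * Real.exp (-(l * F x))) μ)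
    (h1 : ∀ l : ℝ, Integrable (fun x => w x * (F x * Real.exp (-(l * F x)))) μ)
    {l : ℝ} (hZ : postZ μ w F l ≠ 0) :
    HasDerivAt (fun t => Real.log (postZ μ w F t)) (-postMean μ w F l) l := by
  have hd : HasDerivAt (postZ μ w F) _ l := hasDerivAt_integral_mul_exp_neg h0 h1 l
  refine (hd.log hZ).congr_deriv ?_
  rw [postMean]
  ring

lemma hasDerivAt_postMean {X : Type*} [MeasurableSpace X] {μ : Measure X} {w F : X → ℝ}
    (h0 : ∀ l : ℝ, Integrable (fun x => w x * Real.exp (-(l * F x))) μ)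
    (h1 : ∀ l : ℝ, Integrable (fun x => w x * (F x * Real.exp (-(l * F x)))) μ)
    (h2 : ∀ l : ℝ, Integrable (fun x => w x * (F x ^ 2 * Real.exp (-(l * F x)))) μ)
    {l : ℝ} (hZ : postZ μ w F l ≠ 0) :
    HasDerivAt (postMean μ w F) (-postVar μ w F l) l := by
  have hd : HasDerivAt (postZ μ w F) _ l := hasDerivAt_integral_mul_exp_neg h0 h1 l
  have hd1 : HasDerivAt (fun t => ∫ x, w x * (F x * Real.exp (-(t * F x))) ∂μ)
      (-∫ x, w x * (F x ^ 2 * Real.exp (-(l * F x))) ∂μ) l := by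
    have h := hasDerivAt_integral_mul_exp_neg (μ := μ) (F := F) (g := fun x => w x * F x)
      (fun t => by simpa only [mul_assoc] using h1 t)
      (fun t => by simpa only [mul_assoc, sq] using h2 t) l
    simpa only [mul_assoc, sq] using h
  have hfun : postMean μ w F =
      (fun t => ∫ x, w x * (F x * Real.exp (-(t * F x))) ∂μ) / postZ μ w F := by
    ext t
    simp only [postMean, Pi.div_apply]
    ring
  rw [hfun]
  refine (hd1.div hd hZ).congr_deriv ?_
  rw [postVar, postMean]
  generalize ∫ x, w x * (F x ^ 2 * Real.exp (-(l * F x))) ∂μ = a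
  generalize ∫ x, w x * (F x * Real.exp (-(l * F x))) ∂μ = b
  field_simp
  ring

/-- for a field potential `λ F` linear in the parameter and a flat
parameter prior, the parameter posterior potential `Hd(λ) = log Z(λ) - log Zℓ(λ)` is
twice differentiable with `Hd'(λ) = E_post,λ[F] - E_prior,λ[F]` and
`Hd''(λ) = Var_prior,λ[F] - Var_post,λ[F]`. -/
theorem stmt_10 {X : Type*} [MeasurableSpace X] (μ : Measure X) [SigmaFinite μ]
    (F : X → ℝ) (hF : Measurable F) (ℓ : X → ℝ) (hℓmeas : Measurable ℓ)
    (hℓnonneg : ∀ x, 0 ≤ ℓ x)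
    (hint0 : ∀ l : ℝ, Integrable (fun x => Real.exp (-(l * F x))) μ)
    (hint1 : ∀ l : ℝ, Integrable (fun x => F x * Real.exp (-(l * F x))) μ)
    (hint2 : ∀ l : ℝ, Integrable (fun x => F x ^ 2 * Real.exp (-(l * F x))) μ)
    (hint0ℓ : ∀ l : ℝ, Integrable (fun x => ℓ x * Real.exp (-(l * F x))) μ)
    (hint1ℓ : ∀ l : ℝ, Integrable (fun x => ℓ x * (F x * Real.exp (-(l * F x)))) μ)
    (hint2ℓ : ∀ l : ℝ, Integrable (fun x => ℓ x * (F x ^ 2 * Real.exp (-(l * F x)))) μ)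
    (hZpos : ∀ l : ℝ, 0 < priorZ μ F l) (hZℓpos : ∀ l : ℝ, 0 < postZ μ ℓ F l) :
    (∀ l : ℝ, HasDerivAt (fun t => Real.log (priorZ μ F t) - Real.log (postZ μ ℓ F t))
        (postMean μ ℓ F l - priorMean μ F l) l) ∧
    (∀ l : ℝ, HasDerivAt (fun t => postMean μ ℓ F t - priorMean μ F t)
        (priorVar μ F l - postVar μ ℓ F l) l) := by
  have hZ : postZ μ (fun _ => 1) F = priorZ μ F := by
    ext t
    simp only [postZ, priorZ, one_mul]
  have hM : postMean μ (fun _ => 1) F = priorMean μ F := by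
    ext t
    simp only [postMean, priorMean, hZ, one_mul]
  have hV : postVar μ (fun _ => 1) F = priorVar μ F := by
    ext t
    simp only [postVar, priorVar, hZ, hM, one_mul]
  rw [← hZ] at hZpos
  rw [← hZ, ← hM, ← hV]
  have h0 : ∀ l : ℝ, Integrable (fun x => 1 * Real.exp (-(l * F x))) μ := by
    simpa only [one_mul] using hint0
  have h1 : ∀ l : ℝ, Integrable (fun x => 1 * (F x * Real.exp (-(l * F x)))) μ := by
    simpa only [one_mul] using hint1
  have h2 : ∀ l : ℝ, Integrable (fun x => 1 * (F x ^ 2 * Real.exp (-(l * F x)))) μ := by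
    simpa only [one_mul] using hint2
  refine ⟨fun l => ?_, fun l => ?_⟩
  · exact ((hasDerivAt_log_postZ h0 h1 (hZpos l).ne').sub
      (hasDerivAt_log_postZ hint0ℓ hint1ℓ (hZℓpos l).ne')).congr_deriv (by ring)
  · exact ((hasDerivAt_postMean hint0ℓ hint1ℓ hint2ℓ (hZℓpos l).ne').sub
      (hasDerivAt_postMean h0 h1 h2 (hZpos l).ne')).congr_deriv (by ring)
end
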